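/- Let α₁, α₂, α₃, β₁, β₂, β₃ be real numbers with each α_j/π and β_j/π rational, and suppose there exists a nonzero complex number λ with Z(α₁)·X(α₂)·Z(α₃) = λ·X(β₁)·Z(β₂)·X(β₃). Then the tuple (α₁, α₂, α₃, β₁, β₂, β₃) or the color-swapped tuple (β₁, β₂, β₃, α₁, α₂, α₃) is, componentwise modulo 2π, of one of the following seven forms, for some integers n, m and real numbers a, b: (nπ, (−1)^n a, b + nπ, a + mπ, (−1)^m b, mπ); ((m + n)π, (−1)^n a, nπ, (−1)^m b, mπ, a − b); (mπ − a, nπ, (−1)^n a, (−1)^m b, mπ, nπ − b); (nπ + π/2, nπ + π/2, nπ + b, mπ + b, mπ + π/2, mπ + π/2); (nπ − π/2, nπ + π/2, nπ + b, mπ − b, mπ − π/2, mπ + π/2); (nπ + π/2, nπ + b, mπ − π/2, nπ − π/2, mπ + b, mπ + π/2); (nπ + π/2, nπ + b, mπ − π/2, nπ + π/2, mπ − b, mπ − π/2). -/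

import Mathlib

/-- The green-node (Z) rotation matrix. -/
noncomputable def Zm (θ : ℝ) : Matrix (Fin 2) (Fin 2) ℂ :=
  !![1, 0; 0, Complex.exp (θ * Complex.I)]

/-- The red-node (X) rotation matrix. -/
noncomputable def Xm (θ : ℝ) : Matrix (Fin 2) (Fin 2) ℂ :=
  (1 / 2 : ℂ) •
    !![1 + Complex.exp (θ * Complex.I), 1 - Complex.exp (θ * Complex.I);
       1 - Complex.exp (θ * Complex.I), 1 + Complex.exp (θ * Complex.I)]

/-- Congruence modulo `2π`. -/
def Cong (u v : ℝ) : Prop := ∃ k : ℤ, u - v = 2 * Real.pi * k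

/-- Componentwise congruence modulo `2π` of two 6-tuples. -/
def Cong6 (u₁ u₂ u₃ u₄ u₅ u₆ v₁ v₂ v₃ v₄ v₅ v₆ : ℝ) : Prop :=
  Cong u₁ v₁ ∧ Cong u₂ v₂ ∧ Cong u₃ v₃ ∧ Cong u₄ v₄ ∧ Cong u₅ v₅ ∧ Cong u₆ v₆

/-- The seven families of provable Euler equalities. -/
def EulerForm (u₁ u₂ u₃ u₄ u₅ u₆ : ℝ) : Prop :=
  ∃ (n m : ℤ) (a b : ℝ),
    Cong6 u₁ u₂ u₃ u₄ u₅ u₆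
      (n * Real.pi) ((-1) ^ n * a) (b + n * Real.pi)
      (a + m * Real.pi) ((-1) ^ m * b) (m * Real.pi) ∨
    Cong6 u₁ u₂ u₃ u₄ u₅ u₆
      ((m + n) * Real.pi) ((-1) ^ n * a) (n * Real.pi)
      ((-1) ^ m * b) (m * Real.pi) (a - b) ∨
    Cong6 u₁ u₂ u₃ u₄ u₅ u₆
      (m * Real.pi - a) (n * Real.pi) ((-1) ^ n * a)
      ((-1) ^ m * b) (m * Real.pi) (n * Real.pi - b) ∨
    Cong6 u₁ u₂ u₃ u₄ u₅ u₆
      (n * Real.pi + Real.pi / 2) (n * Real.pi + Real.pi / 2) (n * Real.pi + b)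
      (m * Real.pi + b) (m * Real.pi + Real.pi / 2) (m * Real.pi + Real.pi / 2) ∨
    Cong6 u₁ u₂ u₃ u₄ u₅ u₆
      (n * Real.pi - Real.pi / 2) (n * Real.pi + Real.pi / 2) (n * Real.pi + b)
      (m * Real.pi - b) (m * Real.pi - Real.pi / 2) (m * Real.pi + Real.pi / 2) ∨
    Cong6 u₁ u₂ u₃ u₄ u₅ u₆
      (n * Real.pi + Real.pi / 2) (n * Real.pi + b) (m * Real.pi - Real.pi / 2)
      (n * Real.pi - Real.pi / 2) (m * Real.pi + b) (m * Real.pi + Real.pi / 2) ∨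
    Cong6 u₁ u₂ u₃ u₄ u₅ u₆
      (n * Real.pi + Real.pi / 2) (n * Real.pi + b) (m * Real.pi - Real.pi / 2)
      (n * Real.pi + Real.pi / 2) (m * Real.pi - b) (m * Real.pi - Real.pi / 2)


/-- a valuation on `ℂ` above `2` -/
lemma exists_val2 : ∃ B : ValuationSubring ℂ, B.valuation 2 < 1 := by
  obtain ⟨B, -, hB⟩ := Ideal.image_subset_nonunits_valuationSubring
    (A := (Int.castRingHom ℂ).range)
    (Ideal.span {(⟨2, ⟨2, by simp⟩⟩ : (Int.castRingHom ℂ).range)}) (by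
      intro h
      rw [Ideal.eq_top_iff_one, Ideal.mem_span_singleton] at h
      obtain ⟨⟨c, ⟨k, hk⟩⟩, hc⟩ := h
      have h1 := congrArg Subtype.val hc
      simp only [Subring.coe_mul, Subring.coe_one] at h1
      rw [← hk] at h1
      have h2 : (1 : ℤ) = 2 * k := by
        have h3 : ((1 : ℤ) : ℂ) = ((2 * k : ℤ) : ℂ) := by simpa using h1
        exact_mod_cast h3
      omega)
  refine ⟨B, ?_⟩
  have := hB ⟨_, Ideal.subset_span rfl, rfl⟩
  exact (ValuationSubring.mem_nonunits_iff B).1 this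

section
variable {Γ : Type*} [LinearOrderedCommGroupWithZero Γ] (v : Valuation ℂ Γ)

lemma val_ru {z : ℂ} {n : ℕ} (hn : 0 < n) (h : z ^ n = 1) : v z = 1 := by
  have : (v z) ^ n = 1 := by rw [← map_pow, h, map_one]
  exact (pow_eq_one_iff_of_nonneg zero_le hn.ne').1 this

lemma val_odd (h2 : v 2 < 1) (k : ℕ) : v ((2 * k + 1 : ℕ) : ℂ) = 1 := by
  have hk : v (k : ℂ) ≤ 1 := by
    induction k with
    | zero => simp
    | succ k ih => push_cast; exact (v.map_add _ _).trans (max_le ih (by simp))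
  have : v (2 * (k : ℂ)) < v 1 := by
    rw [map_mul, map_one]
    exact mul_lt_one_of_lt_of_le h2 hk
  push_cast
  rw [v.map_add_eq_of_lt_right this, map_one]

lemma val_geom {z : ℂ} {t : Γ} (hz : v z ≤ 1) (h : v (z - 1) ≤ t) (n : ℕ) :
    v (∑ i ∈ Finset.range n, z ^ i - n) ≤ t := by
  have hp : ∀ i : ℕ, v (z ^ i - 1) ≤ t := by
    intro i
    induction i with
    | zero => simp
    | succ i ih =>
      have : z ^ (i + 1) - 1 = z * (z ^ i - 1) + (z - 1) := by ring
      rw [this]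
      refine (v.map_add _ _).trans (max_le ?_ h)
      rw [map_mul]
      exact (mul_le_of_le_one_left' hz).trans ih
  induction n with
  | zero => simp
  | succ n ih =>
    rw [Finset.sum_range_succ]
    have : ∑ x ∈ Finset.range n, z ^ x + z ^ n - ((n + 1 : ℕ) : ℂ)
      = (∑ x ∈ Finset.range n, z ^ x - n) + (z ^ n - 1) := by push_cast; ring
    rw [this]
    exact (v.map_add _ _).trans (max_le ih (hp n))

lemma no_ru (h2 : v 2 < 1) (n : ℕ) : 0 < n → ∀ z : ℂ, v (z - 1) < v 2 → z ^ n = 1 → z = 1 := by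
  induction n using Nat.strong_induction_on with
  | _ n ih =>
    intro hn z hz hzn
    have hv2 : v 2 ≠ 0 := by simp
    rcases Nat.even_or_odd' n with ⟨k, rfl | rfl⟩
    · have h1 : v (z + 1) = v 2 := by
        have : z + 1 = (z - 1) + 2 := by ring
        rw [this, v.map_add_eq_of_lt_right hz]
      have h3 : z ^ 2 = 1 := by
        refine ih k (by omega) (by omega) (z ^ 2) ?_ (by rw [← pow_mul]; exact hzn)
        have : z ^ 2 - 1 = (z - 1) * (z + 1) := by ring
        rw [this, map_mul, h1]
        exact (mul_le_of_le_one_right' h2.le).trans_lt hz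
      have h4 : (z - 1) * (z + 1) = 0 := by linear_combination h3
      rcases mul_eq_zero.1 h4 with h5 | h5
      · linear_combination h5
      · rw [h5, map_zero] at h1
        exact absurd h1.symm hv2
    · have hg := val_geom v (val_ru v hn hzn).le (le_refl (v (z - 1))) (2 * k + 1)
      have h5 := (geom_sum_mul z (2 * k + 1))
      rw [hzn, sub_self] at h5
      rcases mul_eq_zero.1 h5 with h6 | h6
      · rw [h6, zero_sub, Valuation.map_neg, val_odd v h2] at hg
        exact absurd (hg.trans_lt (hz.trans h2)) (lt_irrefl _)
      · linear_combination h6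

/-- key estimate -/
lemma key_val (h2 : v 2 < 1) {z : ℂ} {n : ℕ} (hn : 0 < n) (hzn : z ^ n = 1) (h1 : z ^ 2 ≠ 1) :
    v 2 ≤ v (z - 1) ^ 2 := by
  by_contra hlt
  push Not at hlt
  have ht1 : v (z - 1) < 1 := by
    by_contra hge
    push Not at hge
    exact absurd (hlt.trans h2) (not_lt.2 (one_le_pow₀ hge))
  apply h1
  refine no_ru v h2 n hn (z ^ 2) ?_ (by rw [← pow_mul, mul_comm, pow_mul, hzn, one_pow])
  have : z ^ 2 - 1 = 2 * (z - 1) + (z - 1) ^ 2 := by ring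
  rw [this]
  refine (v.map_add _ _).trans_lt (max_lt ?_ (by rw [map_pow]; exact hlt))
  rw [map_mul]
  have hv2 : 0 < v 2 := by simp [zero_lt_iff]
  exact mul_lt_of_lt_one_right hv2 ht1

lemma key_val2 (h2 : v 2 < 1) {x : ℂ} {n : ℕ} (hn : 0 < n) (hx : x ^ n = 1) (h1 : x ^ 4 ≠ 1) :
    v (x ^ 2 + 1) = v (x ^ 2 - 1) ∧ v 2 ≤ v (x ^ 2 - 1) ^ 2 ∧ v 2 < v (x ^ 2 - 1) := by
  have h3 : v 2 ≤ v (x ^ 2 - 1) ^ 2 :=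
    key_val v h2 hn (by rw [← pow_mul, mul_comm, pow_mul, hx, one_pow])
      (by rw [← pow_mul]; exact h1)
  have h4 : v 2 < v (x ^ 2 - 1) := by
    by_contra hge
    push Not at hge
    have hv2 : 0 < v 2 := by simp [zero_lt_iff]
    have h5 : v (x ^ 2 - 1) ^ 2 ≤ v 2 ^ 2 := pow_le_pow_left₀ zero_le hge 2
    have h6 : v 2 ^ 2 < v 2 := by rw [sq]; exact mul_lt_of_lt_one_right hv2 h2
    exact absurd (h3.trans (h5)) (not_le.2 h6)
  refine ⟨?_, h3, h4⟩
  have : x ^ 2 + 1 = 2 + (x ^ 2 - 1) := by ring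
  rw [this, v.map_add_eq_of_lt_right h4]

end

lemma triple_ru {x1 x2 x3 y2 : ℂ} {n : ℕ} (hn : 0 < n) (h1 : x1 ^ n = 1) (h2 : x2 ^ n = 1)
    (h3 : x3 ^ n = 1) (h4 : y2 ^ n = 1)
    (R : 4 * x1 * x2 * x3 * (y2 ^ 2 + 1) =
      y2 * (2 * x2 * (x1 ^ 2 + 1) * (x3 ^ 2 + 1) + (x2 ^ 2 + 1) * (x1 ^ 2 - 1) * (x3 ^ 2 - 1))) :
    x1 ^ 4 = 1 ∨ x2 ^ 4 = 1 ∨ x3 ^ 4 = 1 := by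
  by_contra hcon
  push Not at hcon
  obtain ⟨g1, g2, g3⟩ := hcon
  obtain ⟨B, hB⟩ := exists_val2
  set v := B.valuation with hv
  obtain ⟨a1, b1, c1⟩ := key_val2 v hB hn h1 g1
  obtain ⟨a2, b2, c2⟩ := key_val2 v hB hn h2 g2
  obtain ⟨a3, b3, c3⟩ := key_val2 v hB hn h3 g3
  have hR := congrArg v R
  have hv2 : 0 < v 2 := by simp [zero_lt_iff]
  have p1 : 0 < v (x1 ^ 2 - 1) := hv2.trans c1
  have p2 : 0 < v (x2 ^ 2 - 1) := hv2.trans c2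
  have p3 : 0 < v (x3 ^ 2 - 1) := hv2.trans c3
  have hlt : v (2 * x2 * (x1 ^ 2 + 1) * (x3 ^ 2 + 1)) <
      v ((x2 ^ 2 + 1) * (x1 ^ 2 - 1) * (x3 ^ 2 - 1)) := by
    simp only [map_mul, a1, a2, a3, val_ru v hn h2, mul_one]
    exact mul_lt_mul_of_pos_right (mul_lt_mul_of_pos_right c2 p1) p3
  rw [map_mul v y2, v.map_add_eq_of_lt_right hlt] at hR
  have h44 : v 4 = v 2 ^ 2 := by rw [← map_pow]; norm_num
  simp only [map_mul, a2, val_ru v hn h2, val_ru v hn h1, val_ru v hn h3, val_ru v hn h4,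
    mul_one, one_mul, h44] at hR
  have hy : v (y2 ^ 2 + 1) ≤ 1 := by
    refine (v.map_add _ _).trans (max_le ?_ (by simp))
    rw [map_pow, val_ru v hn h4, one_pow]
  have u1 : v (x2 ^ 2 - 1) * v (x1 ^ 2 - 1) * v (x3 ^ 2 - 1) ≤ v 2 ^ 2 := by
    rw [← hR]; exact mul_le_of_le_one_right' hy
  have u2 : (v (x2 ^ 2 - 1) * v (x1 ^ 2 - 1) * v (x3 ^ 2 - 1)) ^ 2 ≤ (v 2 ^ 2) ^ 2 :=
    pow_le_pow_left₀ zero_le u1 2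
  have u3 : v 2 * v 2 * v 2 ≤ (v (x2 ^ 2 - 1) * v (x1 ^ 2 - 1) * v (x3 ^ 2 - 1)) ^ 2 := by
    rw [mul_pow, mul_pow]
    exact mul_le_mul' (mul_le_mul' b2 b1) b3
  have u4 : (v 2 ^ 2) ^ 2 < v 2 * v 2 * v 2 := by
    have : (v 2 ^ 2) ^ 2 = v 2 * v 2 * v 2 * v 2 := by simp only [sq, mul_assoc]
    rw [this]
    exact mul_lt_of_lt_one_right (by positivity) hB
  exact absurd (u3.trans u2) (not_le.2 u4)
/-- polynomial form of the Euler equation -/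
def Sys (l x1 x2 x3 y1 y2 y3 : ℂ) : Prop :=
  (1 + x2) * (1 + x1 * x3) + (1 - x2) * (x1 + x3) = 2 * l * (1 + y2) ∧
  (1 + x2) * (1 + x1 * x3) - (1 - x2) * (x1 + x3) = 2 * l * ((1 + y2) * y1 * y3) ∧
  (1 + x2) * (1 - x1 * x3) + (1 - x2) * (x1 - x3) = 2 * l * ((1 - y2) * y3) ∧
  (1 + x2) * (1 - x1 * x3) - (1 - x2) * (x1 - x3) = 2 * l * ((1 - y2) * y1)

lemma Sys.swap {l x1 x2 x3 y1 y2 y3 : ℂ} (hl : l ≠ 0) (h : Sys l x1 x2 x3 y1 y2 y3) :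
    Sys l⁻¹ y1 y2 y3 x1 x2 x3 := by
  obtain ⟨h1, h2, h3, h4⟩ := h
  refine ⟨?_, ?_, ?_, ?_⟩ <;> field_simp
  · linear_combination -(h1+h2+h3+h4)/2
  · linear_combination -(h1+h2-h3-h4)/2
  · linear_combination -(h1-h2-h3+h4)/2
  · linear_combination -(h1-h2+h3-h4)/2

lemma Sys.rot {l x1 x2 x3 y1 y2 y3 : ℂ} (hx : x1 ≠ 0) (hy : y3 ≠ 0)
    (h : Sys l x1 x2 x3 y1 y2 y3) :
    Sys l x2 x3 y3⁻¹ x1⁻¹ y1 y2 := by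
  obtain ⟨h1, h2, h3, h4⟩ := h
  have e1 : 2 * (1 + x2) = l * ((1 + y1) * (1 + y3) + y2 * (1 - y1) * (1 - y3)) := by
    linear_combination (h1 + h2 + h3 + h4) / 2
  refine ⟨?_, ?_, ?_, ?_⟩ <;> field_simp <;> grind

lemma Sys.R {l x1 x2 x3 y1 y2 y3 : ℂ} (h : Sys l x1 x2 x3 y1 y2 y3) : 
    4 * x1 * x2 * x3 * (y2 ^ 2 + 1) =
      y2 * (2 * x2 * (x1 ^ 2 + 1) * (x3 ^ 2 + 1) + (x2 ^ 2 + 1) * (x1 ^ 2 - 1) * (x3 ^ 2 - 1)) := by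
  obtain ⟨h1, h2, h3, h4⟩ := h
  have hA : ((1 + x2) * (1 + x1 * x3) + (1 - x2) * (x1 + x3)) * ((1 + x2) * (1 + x1 * x3) - (1 - x2) * (x1 + x3)) = (2 * l * (1 + y2)) * (2 * l * ((1 + y2) * y1 * y3)) := by rw [h1, h2]
  have hB : ((1 + x2) * (1 - x1 * x3) + (1 - x2) * (x1 - x3)) * ((1 + x2) * (1 - x1 * x3) - (1 - x2) * (x1 - x3)) = (2 * l * ((1 - y2) * y3)) * (2 * l * ((1 - y2) * y1)) := by rw [h3, h4]
  have hd : x1 * x2 * x3 = l ^ 2 * (y1 * y2 * y3) := by linear_combination (hA - hB) / 16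
  linear_combination 4 * (y2^2+1) * hd - y2 * (hA + hB)/2

/-- `X = A ^ s` for a sign `s` -/
def Pw (s X A : ℂ) : Prop := (s = 1 ∧ X = A) ∨ (s = -1 ∧ X * A = 1)

def F1 (n m x1 x2 x3 y1 y2 y3 : ℂ) : Prop :=
  x1 = n ∧ y3 = m ∧ Pw n x2 (y1 * m) ∧ Pw m y2 (x3 * n)
def F2 (n m x1 x2 x3 y1 y2 y3 : ℂ) : Prop :=
  x3 = n ∧ y2 = m ∧ x1 = m * n ∧
    ((m = 1 ∧ Pw n x2 (y3 * y1)) ∨ (m = -1 ∧ n = 1 ∧ x2 * y1 = y3) ∨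
      (m = -1 ∧ n = -1 ∧ x2 * y3 = y1))
def F3 (n m x1 x2 x3 y1 y2 y3 : ℂ) : Prop :=
  x2 = n ∧ y2 = m ∧ ((n = 1 ∧ x1 * x3 = m) ∨ (n = -1 ∧ x1 = m * x3)) ∧
    ((m = 1 ∧ y1 * y3 = n) ∨ (m = -1 ∧ y3 = n * y1))
def F4 (n m x1 x2 x3 y1 y2 y3 : ℂ) : Prop :=
  x1 = n * Complex.I ∧ x2 = n * Complex.I ∧ y2 = m * Complex.I ∧ y3 = m * Complex.I ∧
    x3 * n = y1 * m
def F5 (n m x1 x2 x3 y1 y2 y3 : ℂ) : Prop :=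
  x1 = -n * Complex.I ∧ x2 = n * Complex.I ∧ y2 = -m * Complex.I ∧ y3 = m * Complex.I ∧
    x3 * y1 = n * m
def F6 (n m x1 x2 x3 y1 y2 y3 : ℂ) : Prop :=
  x1 = n * Complex.I ∧ x3 = -m * Complex.I ∧ y1 = -n * Complex.I ∧ y3 = m * Complex.I ∧
    x2 * n = y2 * m
def F7 (n m x1 x2 x3 y1 y2 y3 : ℂ) : Prop :=
  x1 = n * Complex.I ∧ x3 = -m * Complex.I ∧ y1 = n * Complex.I ∧ y3 = -m * Complex.I ∧
    x2 * y2 = n * m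

def CF (x1 x2 x3 y1 y2 y3 : ℂ) : Prop :=
  ∃ n m : ℂ, (n = 1 ∨ n = -1) ∧ (m = 1 ∨ m = -1) ∧
    (F1 n m x1 x2 x3 y1 y2 y3 ∨ F2 n m x1 x2 x3 y1 y2 y3 ∨ F3 n m x1 x2 x3 y1 y2 y3 ∨
     F4 n m x1 x2 x3 y1 y2 y3 ∨ F5 n m x1 x2 x3 y1 y2 y3 ∨ F6 n m x1 x2 x3 y1 y2 y3 ∨
     F7 n m x1 x2 x3 y1 y2 y3)

lemma Sys.flip {l x1 x2 x3 y1 y2 y3 : ℂ} (h : Sys l x1 x2 x3 y1 y2 y3) :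
    Sys l x3 x2 x1 y3 y2 y1 := by
  obtain ⟨h1, h2, h3, h4⟩ := h
  exact ⟨by linear_combination h1, by linear_combination h2, by linear_combination h4,
    by linear_combination h3⟩

/-- a symmetric disjunction -/
def CG (x1 x2 x3 y1 y2 y3 : ℂ) : Prop := CF x1 x2 x3 y1 y2 y3 ∨ CF y1 y2 y3 x1 x2 x3

lemma CG.swap {x1 x2 x3 y1 y2 y3 : ℂ} (h : CG x1 x2 x3 y1 y2 y3) : CG y1 y2 y3 x1 x2 x3 :=
  Or.symm h

lemma CF.flip {x1 x2 x3 y1 y2 y3 : ℂ} (a1 : x1 ≠ 0) (a2 : x2 ≠ 0) (a3 : x3 ≠ 0)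
    (b1 : y1 ≠ 0) (b2 : y2 ≠ 0) (b3 : y3 ≠ 0)
    (h : CF x1 x2 x3 y1 y2 y3) : CG x3 x2 x1 y3 y2 y1 := by
  obtain ⟨n, m, hn, hm, h | h | h | h | h | h | h⟩ := h
  · right
    exact ⟨m, n, hm, hn, Or.inl (by unfold F1 Pw at *; grind)⟩
  · left
    refine ⟨m * n, m, by grind, hm, Or.inr (Or.inl (by unfold F2 Pw at *; grind))⟩
  · left
    exact ⟨n, m, hn, hm, Or.inr (Or.inr (Or.inl (by unfold F3 at *; grind)))⟩
  · right
    exact ⟨m, n, hm, hn, Or.inr (Or.inr (Or.inr (Or.inl (by unfold F4 at *; grind))))⟩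
  · right
    exact ⟨-m, -n, by grind, by grind,
      Or.inr (Or.inr (Or.inr (Or.inr (Or.inl (by unfold F5 at *; grind)))))⟩
  · left
    exact ⟨-m, -n, by grind, by grind,
      Or.inr (Or.inr (Or.inr (Or.inr (Or.inr (Or.inl (by unfold F6 at *; grind))))))⟩
  · left
    exact ⟨-m, -n, by grind, by grind,
      Or.inr (Or.inr (Or.inr (Or.inr (Or.inr (Or.inr (by unfold F7 at *; grind))))))⟩

lemma CG.flip {x1 x2 x3 y1 y2 y3 : ℂ} (a1 : x1 ≠ 0) (a2 : x2 ≠ 0) (a3 : x3 ≠ 0)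
    (b1 : y1 ≠ 0) (b2 : y2 ≠ 0) (b3 : y3 ≠ 0)
    (h : CG x1 x2 x3 y1 y2 y3) : CG x3 x2 x1 y3 y2 y1 := by
  rcases h with h | h
  · exact h.flip a1 a2 a3 b1 b2 b3
  · exact (h.flip b1 b2 b3 a1 a2 a3).swap

lemma Sys.R2 {l x1 x2 x3 y1 y2 y3 : ℂ} (hx : x1 ≠ 0) (hy : y3 ≠ 0)
    (h : Sys l x1 x2 x3 y1 y2 y3) :
    4 * x2 * x3 * y3 * (y1 ^ 2 + 1) =
      y1 * (2 * x3 * (x2 ^ 2 + 1) * (y3 ^ 2 + 1) - (x3 ^ 2 + 1) * (x2 ^ 2 - 1) * (y3 ^ 2 - 1)) := by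
  have := (h.rot hx hy).R
  field_simp at this
  linear_combination this

lemma imp1 {x1 x2 x3 y : ℂ} (s : ℂ) (hs : s = 1 ∨ s = -1) (a1 : x1 ≠ 0) (a2 : x2 ≠ 0)
    (a3 : x3 ≠ 0) (b : y ≠ 0) (n1 : x1 ^ 2 - 1 ≠ 0) (n3 : x3 ^ 2 - 1 ≠ 0)
    (R : 4 * x1 * x2 * x3 * (y ^ 2 + 1) =
      y * (2 * x2 * (x1 ^ 2 + 1) * (x3 ^ 2 + 1) + s * ((x2 ^ 2 + 1) * (x1 ^ 2 - 1) * (x3 ^ 2 - 1)))) :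
    (x1 ^ 2 + 1 = 0 → (y ^ 2 + 1 = 0 ↔ x2 ^ 2 + 1 = 0)) ∧
    (x3 ^ 2 + 1 = 0 → (y ^ 2 + 1 = 0 ↔ x2 ^ 2 + 1 = 0)) ∧
    (y ^ 2 + 1 = 0 → x2 ^ 2 + 1 = 0 → (x1 ^ 2 + 1 = 0 ∨ x3 ^ 2 + 1 = 0)) := by
  have hs0 : s ≠ 0 := by rcases hs with rfl | rfl <;> norm_num
  refine ⟨fun h => ?_, fun h => ?_, fun h h' => ?_⟩
  · rw [h] at R
    constructor
    · intro h'; rw [h'] at R; simpa [b, hs0, n1, n3] using R.symm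
    · intro h'; rw [h'] at R; simpa [a1, a2, a3] using R
  · rw [h] at R
    constructor
    · intro h'; rw [h'] at R; simpa [b, hs0, n1, n3] using R.symm
    · intro h'; rw [h'] at R; simpa [a1, a2, a3] using R
  · rw [h, h'] at R
    simpa [b, a2] using R.symm

lemma cls_pi1 {l x1 x2 x3 y1 y2 y3 : ℂ} (hl : l ≠ 0) (a1 : x1 ≠ 0) (a2 : x2 ≠ 0) (a3 : x3 ≠ 0)
    (b1 : y1 ≠ 0) (b2 : y2 ≠ 0) (b3 : y3 ≠ 0) (h : Sys l x1 x2 x3 y1 y2 y3)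
    (hx : x1 = 1 ∨ x1 = -1) : CG x1 x2 x3 y1 y2 y3 := by
  have hR := h.R
  obtain ⟨h1, h2, h3, h4⟩ := h
  left
  by_cases c : x3 = 1 ∨ x3 = -1
  · refine ⟨x3, x1 * x3, c,
      by rcases hx with rfl | rfl <;> rcases c with rfl | rfl <;> norm_num, Or.inr (Or.inl ?_)⟩
    rcases hx with rfl | rfl <;> rcases c with rfl | rfl
    · have : y2 = 1 := by grind
      subst this
      refine ⟨rfl, by ring, by ring, Or.inl ⟨by ring, Or.inl ⟨rfl, by grind⟩⟩⟩
    · have : y2 = -1 := by grind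
      subst this
      refine ⟨rfl, by ring, by ring, Or.inr (Or.inr ⟨by ring, rfl, by grind⟩)⟩
    · have : y2 = -1 := by grind
      subst this
      refine ⟨rfl, by ring, by ring, Or.inr (Or.inl ⟨by ring, rfl, by grind⟩)⟩
    · have : y2 = 1 := by grind
      subst this
      refine ⟨rfl, by ring, by ring, Or.inl ⟨by ring, Or.inr ⟨rfl, by grind⟩⟩⟩
  · push Not at c
    obtain ⟨c1, c2⟩ := c
    have d1 : x3 - 1 ≠ 0 := sub_ne_zero.2 c1
    have d2 : x3 + 1 ≠ 0 := fun h => c2 (by linear_combination h)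
    rcases hx with rfl | rfl
    · have e : (y2 - x3) * (x3 * y2 - 1) = 0 := by grind
      rcases mul_eq_zero.1 e with e | e
      · have : y2 = x3 := by linear_combination e
        subst this
        have l1 : l = 1 := by grind
        subst l1
        have : y3 = 1 := by grind
        subst this
        exact ⟨1, 1, by simp, by simp, Or.inl ⟨rfl, rfl, Or.inl ⟨rfl, by grind⟩, Or.inl ⟨rfl, by ring⟩⟩⟩
      · have l1 : l = x3 := by grind
        subst l1
        have : y3 = -1 := by grind
        subst this
        exact ⟨1, -1, by simp, by simp, Or.inl ⟨rfl, rfl, Or.inl ⟨rfl, by grind⟩, Or.inr ⟨rfl, by grind⟩⟩⟩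
    · have e : (y2 + x3) * (x3 * y2 + 1) = 0 := by grind
      rcases mul_eq_zero.1 e with e | e
      · have : y2 = -x3 := by linear_combination e
        subst this
        have : l = x2 := by grind
        subst this
        have : y3 = 1 := by grind
        subst this
        exact ⟨-1, 1, by simp, by simp, Or.inl ⟨rfl, rfl, Or.inr ⟨rfl, by grind⟩, Or.inl ⟨rfl, by ring⟩⟩⟩
      · have : l = - x2 * x3 := by grind
        subst this
        have : y3 = -1 := by grind
        subst this
        exact ⟨-1, -1, by simp, by simp, Or.inl ⟨rfl, rfl, Or.inr ⟨rfl, by grind⟩, Or.inr ⟨rfl, by grind⟩⟩⟩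

lemma cls_pi2 {l x1 x2 x3 y1 y2 y3 : ℂ} (hl : l ≠ 0) (a1 : x1 ≠ 0) (a2 : x2 ≠ 0) (a3 : x3 ≠ 0)
    (b1 : y1 ≠ 0) (b2 : y2 ≠ 0) (b3 : y3 ≠ 0) (h : Sys l x1 x2 x3 y1 y2 y3)
    (hx : x2 = 1 ∨ x2 = -1) : CG x1 x2 x3 y1 y2 y3 := by
  obtain ⟨h1, h2, h3, h4⟩ := h
  by_cases c : y2 = 1 ∨ y2 = -1
  · left
    refine ⟨x2, y2, hx, c, Or.inr (Or.inr (Or.inl ?_))⟩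
    rcases hx with rfl | rfl <;> rcases c with rfl | rfl
    · exact ⟨rfl, rfl, Or.inl ⟨rfl, by grind⟩, Or.inl ⟨rfl, by grind⟩⟩
    · exact ⟨rfl, rfl, Or.inl ⟨rfl, by grind⟩, Or.inr ⟨rfl, by grind⟩⟩
    · exact ⟨rfl, rfl, Or.inr ⟨rfl, by grind⟩, Or.inl ⟨rfl, by grind⟩⟩
    · exact ⟨rfl, rfl, Or.inr ⟨rfl, by grind⟩, Or.inr ⟨rfl, by grind⟩⟩
  · right
    push Not at c
    obtain ⟨c1, c2⟩ := c
    have d1 : 1 - y2 ≠ 0 := sub_ne_zero.2 (Ne.symm c1)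
    have d2 : 1 + y2 ≠ 0 := fun h => c2 (by linear_combination h)
    rcases hx with rfl | rfl
    · have e1 : y1 * y3 = 1 := by
        have : l * (1 + y2) * (y1 * y3 - 1) = 0 := by linear_combination (h1 - h2) / 2
        simp [hl, d2] at this
        linear_combination this
      have e2 : y1 = y3 := by
        have : l * (1 - y2) * (y1 - y3) = 0 := by linear_combination (h3 - h4) / 2
        simp [hl, d1] at this
        linear_combination this
      subst e2
      have e3 : y1 = 1 ∨ y1 = -1 := by
        have : (y1 - 1) * (y1 + 1) = 0 := by linear_combination e1
        rcases mul_eq_zero.1 this with h | h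
        · left; linear_combination h
        · right; linear_combination h
      refine ⟨y1, 1, e3, by simp, Or.inr (Or.inl ⟨rfl, rfl, by ring, Or.inl ⟨rfl, ?_⟩⟩)⟩
      rcases e3 with rfl | rfl
      · left; exact ⟨rfl, by grind⟩
      · right; exact ⟨rfl, by grind⟩
    · have e1 : y1 * y3 = -1 := by
        have : l * (1 + y2) * (y1 * y3 + 1) = 0 := by linear_combination -(h1 + h2) / 2
        simp [hl, d2] at this
        linear_combination this
      have e2 : y1 = -y3 := by
        have : l * (1 - y2) * (y1 + y3) = 0 := by linear_combination -(h3 + h4) / 2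
        simp [hl, d1] at this
        linear_combination this
      subst e2
      have e3 : y3 = 1 ∨ y3 = -1 := by
        have : (y3 - 1) * (y3 + 1) = 0 := by linear_combination -e1
        rcases mul_eq_zero.1 this with h | h
        · left; linear_combination h
        · right; linear_combination h
      refine ⟨y3, -1, e3, by simp, Or.inr (Or.inl ⟨rfl, rfl, by ring, Or.inr ?_⟩)⟩
      rcases e3 with rfl | rfl
      · left; exact ⟨rfl, rfl, by grind⟩
      · right; exact ⟨rfl, rfl, by grind⟩

lemma sq_I {x : ℂ} (h : x ^ 2 + 1 = 0) :
    ∃ n : ℂ, (n = 1 ∨ n = -1) ∧ x = n * Complex.I := by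
  have : (x - Complex.I) * (x + Complex.I) = 0 := by
    linear_combination h - Complex.I_sq
  rcases mul_eq_zero.1 this with h | h
  · exact ⟨1, by simp, by linear_combination h⟩
  · exact ⟨-1, by simp, by linear_combination h⟩

lemma cls_A {l x1 x2 x3 y1 y2 y3 : ℂ} (hl : l ≠ 0) (a1 : x1 ≠ 0) (a2 : x2 ≠ 0) (a3 : x3 ≠ 0)
    (b1 : y1 ≠ 0) (b2 : y2 ≠ 0) (b3 : y3 ≠ 0) (h : Sys l x1 x2 x3 y1 y2 y3)
    (n3 : x3 ^ 2 - 1 ≠ 0) (m1 : y1 ^ 2 - 1 ≠ 0)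
    (q1 : x1 ^ 2 + 1 = 0) (q2 : x2 ^ 2 + 1 = 0) (p2 : y2 ^ 2 + 1 = 0) (p3 : y3 ^ 2 + 1 = 0) :
    CG x1 x2 x3 y1 y2 y3 := by
  obtain ⟨h1, h2, h3, h4⟩ := h
  left
  obtain ⟨n', hn', rfl⟩ := sq_I q1
  obtain ⟨n, hn, rfl⟩ := sq_I q2
  obtain ⟨m', hm', rfl⟩ := sq_I p2
  obtain ⟨m, hm, rfl⟩ := sq_I p3
  have hI := Complex.I_sq
  refine ⟨n, m, hn, hm, Or.inr (Or.inr (Or.inr ?_))⟩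
  unfold F4 F5
  generalize Complex.I = I at *
  rcases hn with rfl | rfl <;> rcases hm with rfl | rfl <;> rcases hn' with rfl | rfl <;>
    rcases hm' with rfl | rfl <;> first
    | (left; refine ⟨?_, ?_, ?_, ?_, ?_⟩ <;> [ring1; ring1; ring1; ring1; grind])
    | (right; left; refine ⟨?_, ?_, ?_, ?_, ?_⟩ <;> [ring1; ring1; ring1; ring1; grind])
    | (exfalso; grind)

lemma cls_B {l x1 x2 x3 y1 y2 y3 : ℂ} (hl : l ≠ 0) (a1 : x1 ≠ 0) (a2 : x2 ≠ 0) (a3 : x3 ≠ 0)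
    (b1 : y1 ≠ 0) (b2 : y2 ≠ 0) (b3 : y3 ≠ 0) (h : Sys l x1 x2 x3 y1 y2 y3)
    (n2 : x2 ^ 2 - 1 ≠ 0) (m2 : y2 ^ 2 - 1 ≠ 0)
    (q1 : x1 ^ 2 + 1 = 0) (q3 : x3 ^ 2 + 1 = 0) (p1 : y1 ^ 2 + 1 = 0) (p3 : y3 ^ 2 + 1 = 0) :
    CG x1 x2 x3 y1 y2 y3 := by
  obtain ⟨h1, h2, h3, h4⟩ := h
  left
  obtain ⟨n, hn, rfl⟩ := sq_I q1
  obtain ⟨m', hm', rfl⟩ := sq_I q3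
  obtain ⟨n', hn', rfl⟩ := sq_I p1
  obtain ⟨m, hm, rfl⟩ := sq_I p3
  have hI := Complex.I_sq
  refine ⟨n, -m', hn, by grind, Or.inr (Or.inr (Or.inr (Or.inr (Or.inr ?_))))⟩
  unfold F6 F7
  generalize Complex.I = I at *
  rcases hn with rfl | rfl <;> rcases hm with rfl | rfl <;> rcases hn' with rfl | rfl <;>
    rcases hm' with rfl | rfl <;> first
    | (left; refine ⟨?_, ?_, ?_, ?_, ?_⟩ <;> [ring1; ring1; ring1; ring1; grind])
    | (right; refine ⟨?_, ?_, ?_, ?_, ?_⟩ <;> [ring1; ring1; ring1; ring1; grind])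
    | (exfalso; grind)

lemma cls_main {l x1 x2 x3 y1 y2 y3 : ℂ} {N : ℕ} (hN : 0 < N) (hl : l ≠ 0)
    (r1 : x1 ^ N = 1) (r2 : x2 ^ N = 1) (r3 : x3 ^ N = 1)
    (s1 : y1 ^ N = 1) (s2 : y2 ^ N = 1) (s3 : y3 ^ N = 1)
    (h : Sys l x1 x2 x3 y1 y2 y3) : CG x1 x2 x3 y1 y2 y3 := by
  have nz : ∀ z : ℂ, z ^ N = 1 → z ≠ 0 := by
    rintro z hz rfl
    rw [zero_pow hN.ne'] at hz
    exact zero_ne_one hz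
  have a1 := nz _ r1
  have a2 := nz _ r2
  have a3 := nz _ r3
  have b1 := nz _ s1
  have b2 := nz _ s2
  have b3 := nz _ s3
  have hsw := h.swap hl
  have hl' := inv_ne_zero hl
  by_cases c1 : x1 = 1 ∨ x1 = -1
  · exact cls_pi1 hl a1 a2 a3 b1 b2 b3 h c1
  by_cases c2 : x2 = 1 ∨ x2 = -1
  · exact cls_pi2 hl a1 a2 a3 b1 b2 b3 h c2
  by_cases c3 : x3 = 1 ∨ x3 = -1
  · exact (cls_pi1 hl a3 a2 a1 b3 b2 b1 h.flip c3).flip a3 a2 a1 b3 b2 b1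
  by_cases d1 : y1 = 1 ∨ y1 = -1
  · exact (cls_pi1 hl' b1 b2 b3 a1 a2 a3 hsw d1).swap
  by_cases d2 : y2 = 1 ∨ y2 = -1
  · exact (cls_pi2 hl' b1 b2 b3 a1 a2 a3 hsw d2).swap
  by_cases d3 : y3 = 1 ∨ y3 = -1
  · exact ((cls_pi1 hl' b3 b2 b1 a3 a2 a1 hsw.flip d3).flip b3 b2 b1 a3 a2 a1).swap
  have sq1 : ∀ z : ℂ, ¬ (z = 1 ∨ z = -1) → z ^ 2 - 1 ≠ 0 := by
    intro z hz h0
    apply hz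
    rcases mul_eq_zero.1 (show (z - 1) * (z + 1) = 0 by linear_combination h0) with h | h
    · left; linear_combination h
    · right; linear_combination h
  have n1 := sq1 _ c1
  have n2 := sq1 _ c2
  have n3 := sq1 _ c3
  have m1 := sq1 _ d1
  have m2 := sq1 _ d2
  have m3 := sq1 _ d3
  have four : ∀ z : ℂ, z ^ 2 - 1 ≠ 0 → z ^ 4 = 1 → z ^ 2 + 1 = 0 := by
    intro z hz h4
    exact (mul_eq_zero.1 (show (z ^ 2 - 1) * (z ^ 2 + 1) = 0 by linear_combination h4)).resolve_left hz
  -- triples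
  have inv1 : ∀ z : ℂ, z ^ N = 1 → z⁻¹ ^ N = 1 := by intro z hz; rw [inv_pow, hz, inv_one]
  have inv4 : ∀ z : ℂ, z⁻¹ ^ 4 = 1 → z ^ 4 = 1 := by
    intro z hz; rw [inv_pow] at hz; exact inv_eq_one.1 hz
  have T1 := triple_ru hN r1 r2 r3 s2 h.R
  have T2 := triple_ru hN r2 r3 (inv1 _ s3) s1 (h.rot a1 b3).R
  have T3 := triple_ru hN r2 r1 (inv1 _ s1) s3 (h.flip.rot a3 b1).R
  have T4 := triple_ru hN s1 s2 s3 r2 hsw.R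
  have T5 := triple_ru hN s2 s3 (inv1 _ r3) r1 (hsw.rot b1 a3).R
  have T6 := triple_ru hN s2 s1 (inv1 _ r1) r3 (hsw.flip.rot b3 a1).R
  replace T1 := T1.imp (four _ n1) (Or.imp (four _ n2) (four _ n3))
  replace T2 := T2.imp (four _ n2) (Or.imp (four _ n3) (fun q => four _ m3 (inv4 _ q)))
  replace T3 := T3.imp (four _ n2) (Or.imp (four _ n1) (fun q => four _ m1 (inv4 _ q)))
  replace T4 := T4.imp (four _ m1) (Or.imp (four _ m2) (four _ m3))
  replace T5 := T5.imp (four _ m2) (Or.imp (four _ m3) (fun q => four _ n3 (inv4 _ q)))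
  replace T6 := T6.imp (four _ m2) (Or.imp (four _ m1) (fun q => four _ n1 (inv4 _ q)))
  have I1 := imp1 1 (by simp) a1 a2 a3 b2 n1 n3 (by linear_combination h.R)
  have I2 := imp1 (-1) (by simp) a2 a3 b3 b1 n2 m3 (by linear_combination h.R2 a1 b3)
  have I3 := imp1 (-1) (by simp) a2 a1 b1 b3 n2 m1 (by linear_combination h.flip.R2 a3 b1)
  have I4 := imp1 1 (by simp) b1 b2 b3 a2 m1 m3 (by linear_combination hsw.R)
  have I5 := imp1 (-1) (by simp) b2 b3 a3 a1 m2 n3 (by linear_combination hsw.R2 b1 a3)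
  have I6 := imp1 (-1) (by simp) b2 b1 a1 a3 m2 n1 (by linear_combination hsw.flip.R2 b3 a1)
  have key : (x1 ^ 2 + 1 = 0 ∧ x2 ^ 2 + 1 = 0 ∧ y2 ^ 2 + 1 = 0 ∧ y3 ^ 2 + 1 = 0) ∨
      (x3 ^ 2 + 1 = 0 ∧ x2 ^ 2 + 1 = 0 ∧ y2 ^ 2 + 1 = 0 ∧ y1 ^ 2 + 1 = 0) ∨
      (x1 ^ 2 + 1 = 0 ∧ x3 ^ 2 + 1 = 0 ∧ y1 ^ 2 + 1 = 0 ∧ y3 ^ 2 + 1 = 0) := by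
    generalize (x1 ^ 2 + 1 = 0) = q1 at *
    generalize (x2 ^ 2 + 1 = 0) = q2 at *
    generalize (x3 ^ 2 + 1 = 0) = q3 at *
    generalize (y1 ^ 2 + 1 = 0) = p1 at *
    generalize (y2 ^ 2 + 1 = 0) = p2 at *
    generalize (y3 ^ 2 + 1 = 0) = p3 at *
    clear * - T1 T2 T3 T4 T5 T6 I1 I2 I3 I4 I5 I6
    grind
  rcases key with ⟨q1, q2, p2, p3⟩ | ⟨q3, q2, p2, p1⟩ | ⟨q1, q3, p1, p3⟩
  · exact cls_A hl a1 a2 a3 b1 b2 b3 h n3 m1 q1 q2 p2 p3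
  · exact (cls_A hl a3 a2 a1 b3 b2 b1 h.flip n1 m3 q3 q2 p2 p1).flip a3 a2 a1 b3 b2 b1
  · exact cls_B hl a1 a2 a3 b1 b2 b3 h n2 m2 q1 q3 p1 p3

/-- point on the unit circle -/
noncomputable def ex (u : ℝ) : ℂ := Complex.exp (u * Complex.I)

lemma ex_add (u v : ℝ) : ex (u + v) = ex u * ex v := by
  simp [ex, add_mul, Complex.exp_add]
lemma ex_neg (u : ℝ) : ex (-u) = (ex u)⁻¹ := by
  simp [ex, Complex.exp_neg]
lemma ex_sub (u v : ℝ) : ex (u - v) = ex u * (ex v)⁻¹ := by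
  rw [sub_eq_add_neg, ex_add, ex_neg]
lemma ex_pi : ex Real.pi = -1 := by simp [ex]
lemma ex_zero : ex 0 = 1 := by simp [ex]
lemma ex_pi2 : ex (Real.pi / 2) = Complex.I := by
  simp only [ex]
  push_cast
  exact Complex.exp_pi_div_two_mul_I
lemma ex_ne (u : ℝ) : ex u ≠ 0 := Complex.exp_ne_zero _

lemma cong_of_ex {u v : ℝ} (h : ex u = ex v) : Cong u v := by
  obtain ⟨k, hk⟩ := Complex.exp_eq_exp_iff_exists_int.1 h
  refine ⟨k, ?_⟩
  have h1 : ((u - v : ℝ) : ℂ) * Complex.I = ((2 * Real.pi * k : ℝ) : ℂ) * Complex.I := by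
    push_cast
    linear_combination hk
  exact_mod_cast mul_right_cancel₀ Complex.I_ne_zero h1

lemma ex_ru {u : ℝ} (h : ∃ q : ℚ, u / Real.pi = q) : ∃ N : ℕ, 0 < N ∧ ex u ^ N = 1 := by
  obtain ⟨q, hq⟩ := h
  refine ⟨2 * q.den, by have := q.pos; omega, ?_⟩
  have hu : u = q * Real.pi := by
    rw [← hq]; field_simp
  have hqd : (q : ℂ) * q.den = q.num := by exact_mod_cast Rat.mul_den_eq_num q
  rw [ex, ← Complex.exp_nat_mul, Complex.exp_eq_one_iff]
  refine ⟨q.num, ?_⟩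
  rw [hu, ← hqd]
  push_cast
  ring

lemma lift_CF {u1 u2 u3 w1 w2 w3 : ℝ}
    (h : CF (ex u1) (ex u2) (ex u3) (ex w1) (ex w2) (ex w3)) : EulerForm u1 u2 u3 w1 w2 w3 := by
  have k1 := ex_ne u1
  have k2 := ex_ne u2
  have k3 := ex_ne u3
  have k4 := ex_ne w1
  have k5 := ex_ne w2
  have k6 := ex_ne w3
  have hI := Complex.I_sq
  have hI' : Complex.I⁻¹ = - Complex.I := Complex.inv_I
  obtain ⟨n, m, hn, hm, h⟩ := h
  obtain ⟨n', hn'⟩ : ∃ n' : ℤ, (n = 1 ∧ n' = 0) ∨ (n = -1 ∧ n' = 1) := by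
    rcases hn with rfl | rfl
    · exact ⟨0, by simp⟩
    · exact ⟨1, by simp⟩
  obtain ⟨m', hm'⟩ : ∃ m' : ℤ, (m = 1 ∧ m' = 0) ∨ (m = -1 ∧ m' = 1) := by
    rcases hm with rfl | rfl
    · exact ⟨0, by simp⟩
    · exact ⟨1, by simp⟩
  clear hn hm
  rcases h with h | h | h | h | h | h | h
  · refine ⟨n', m', w1 - m' * Real.pi, u3 - n' * Real.pi, Or.inl ?_⟩
    unfold F1 Pw at h
    rcases hn' with ⟨rfl, rfl⟩ | ⟨rfl, rfl⟩ <;> rcases hm' with ⟨rfl, rfl⟩ | ⟨rfl, rfl⟩ <;>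
    refine ⟨?_, ?_, ?_, ?_, ?_, ?_⟩ <;> apply cong_of_ex <;>
    simp [ex_add, ex_sub, ex_neg, ex_pi, ex_zero, ex_pi2] at h ⊢ <;> grind
  · refine ⟨n', m', w3 + (-1) ^ m' * w1, (-1) ^ m' * w1, Or.inr (Or.inl ?_)⟩
    unfold F2 Pw at h
    rcases hn' with ⟨rfl, rfl⟩ | ⟨rfl, rfl⟩ <;> rcases hm' with ⟨rfl, rfl⟩ | ⟨rfl, rfl⟩ <;>
    refine ⟨?_, ?_, ?_, ?_, ?_, ?_⟩ <;> apply cong_of_ex <;>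
    simp [add_mul, ex_add, ex_sub, ex_neg, ex_pi, ex_zero, ex_pi2] at h ⊢ <;> grind
  · refine ⟨n', m', (-1) ^ n' * u3, (-1) ^ m' * w1, Or.inr (Or.inr (Or.inl ?_))⟩
    unfold F3 at h
    rcases hn' with ⟨rfl, rfl⟩ | ⟨rfl, rfl⟩ <;> rcases hm' with ⟨rfl, rfl⟩ | ⟨rfl, rfl⟩ <;>
    refine ⟨?_, ?_, ?_, ?_, ?_, ?_⟩ <;> apply cong_of_ex <;>
    simp [ex_add, ex_sub, ex_neg, ex_pi, ex_zero, ex_pi2] at h ⊢ <;> grind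
  · refine ⟨n', m', 0, u3 - n' * Real.pi, Or.inr (Or.inr (Or.inr (Or.inl ?_)))⟩
    unfold F4 at h
    rcases hn' with ⟨rfl, rfl⟩ | ⟨rfl, rfl⟩ <;> rcases hm' with ⟨rfl, rfl⟩ | ⟨rfl, rfl⟩ <;>
    refine ⟨?_, ?_, ?_, ?_, ?_, ?_⟩ <;> apply cong_of_ex <;>
    simp [ex_add, ex_sub, ex_neg, ex_pi, ex_zero, ex_pi2] at h ⊢ <;> grind
  · refine ⟨n', m', 0, u3 - n' * Real.pi, Or.inr (Or.inr (Or.inr (Or.inr (Or.inl ?_))))⟩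
    unfold F5 at h
    rcases hn' with ⟨rfl, rfl⟩ | ⟨rfl, rfl⟩ <;> rcases hm' with ⟨rfl, rfl⟩ | ⟨rfl, rfl⟩ <;>
    refine ⟨?_, ?_, ?_, ?_, ?_, ?_⟩ <;> apply cong_of_ex <;>
    simp [ex_add, ex_sub, ex_neg, ex_pi, ex_zero, ex_pi2] at h ⊢ <;> grind
  · refine ⟨n', m', 0, u2 - n' * Real.pi, Or.inr (Or.inr (Or.inr (Or.inr (Or.inr (Or.inl ?_)))))⟩
    unfold F6 at h
    rcases hn' with ⟨rfl, rfl⟩ | ⟨rfl, rfl⟩ <;> rcases hm' with ⟨rfl, rfl⟩ | ⟨rfl, rfl⟩ <;>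
    refine ⟨?_, ?_, ?_, ?_, ?_, ?_⟩ <;> apply cong_of_ex <;>
    simp [ex_add, ex_sub, ex_neg, ex_pi, ex_zero, ex_pi2] at h ⊢ <;> grind
  · refine ⟨n', m', 0, u2 - n' * Real.pi, Or.inr (Or.inr (Or.inr (Or.inr (Or.inr (Or.inr ?_)))))⟩
    unfold F7 at h
    rcases hn' with ⟨rfl, rfl⟩ | ⟨rfl, rfl⟩ <;> rcases hm' with ⟨rfl, rfl⟩ | ⟨rfl, rfl⟩ <;>
    refine ⟨?_, ?_, ?_, ?_, ?_, ?_⟩ <;> apply cong_of_ex <;>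
    simp [ex_add, ex_sub, ex_neg, ex_pi, ex_zero, ex_pi2] at h ⊢ <;> grind

theorem euler_classification (α₁ α₂ α₃ β₁ β₂ β₃ : ℝ)
    (hα₁ : ∃ q : ℚ, α₁ / Real.pi = q) (hα₂ : ∃ q : ℚ, α₂ / Real.pi = q)
    (hα₃ : ∃ q : ℚ, α₃ / Real.pi = q) (hβ₁ : ∃ q : ℚ, β₁ / Real.pi = q)
    (hβ₂ : ∃ q : ℚ, β₂ / Real.pi = q) (hβ₃ : ∃ q : ℚ, β₃ / Real.pi = q)
    (h : ∃ lam : ℂ, lam ≠ 0 ∧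
      Zm α₁ * Xm α₂ * Zm α₃ = lam • (Xm β₁ * Zm β₂ * Xm β₃)) :
    EulerForm α₁ α₂ α₃ β₁ β₂ β₃ ∨ EulerForm β₁ β₂ β₃ α₁ α₂ α₃ := by
  obtain ⟨l, hl, hM⟩ := h
  obtain ⟨N1, p1, e1⟩ := ex_ru hα₁
  obtain ⟨N2, p2, e2⟩ := ex_ru hα₂
  obtain ⟨N3, p3, e3⟩ := ex_ru hα₃
  obtain ⟨N4, p4, e4⟩ := ex_ru hβ₁
  obtain ⟨N5, p5, e5⟩ := ex_ru hβ₂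
  obtain ⟨N6, p6, e6⟩ := ex_ru hβ₃
  have up : ∀ (z : ℂ) (a b : ℕ), z ^ a = 1 → a ∣ b → z ^ b = 1 := by
    rintro z a b hz ⟨c, rfl⟩
    rw [pow_mul, hz, one_pow]
  have hS : Sys l (ex α₁) (ex α₂) (ex α₃) (ex β₁) (ex β₂) (ex β₃) := by
    have m00 := congrFun (congrFun hM 0) 0
    have m01 := congrFun (congrFun hM 0) 1
    have m10 := congrFun (congrFun hM 1) 0
    have m11 := congrFun (congrFun hM 1) 1
    simp only [Zm, Xm, Matrix.mul_apply, Fin.sum_univ_two, Matrix.smul_apply, smul_eq_mul,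
      Matrix.of_apply, Matrix.cons_val_zero, Matrix.cons_val_one, Matrix.cons_val',
      Matrix.cons_val_fin_one] at m00 m01 m10 m11
    have hx : ∀ u : ℝ, Complex.exp (u * Complex.I) = ex u := fun _ => rfl
    simp only [hx] at m00 m01 m10 m11
    refine ⟨?_, ?_, ?_, ?_⟩
    · linear_combination 2 * (m00 + m01 + m10 + m11)
    · linear_combination 2 * (m00 - m01 - m10 + m11)
    · linear_combination 2 * (m00 - m01 + m10 - m11)
    · linear_combination 2 * (m00 + m01 - m10 - m11)
  have hC : CG (ex α₁) (ex α₂) (ex α₃) (ex β₁) (ex β₂) (ex β₃) := by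
    refine cls_main (N := N1 * N2 * N3 * N4 * N5 * N6) (by positivity) hl
      (up _ _ _ e1 ?_) (up _ _ _ e2 ?_) (up _ _ _ e3 ?_) (up _ _ _ e4 ?_) (up _ _ _ e5 ?_)
      (up _ _ _ e6 ?_) hS
    · exact ⟨N2 * N3 * N4 * N5 * N6, by ring⟩
    · exact ⟨N1 * N3 * N4 * N5 * N6, by ring⟩
    · exact ⟨N1 * N2 * N4 * N5 * N6, by ring⟩
    · exact ⟨N1 * N2 * N3 * N5 * N6, by ring⟩
    · exact ⟨N1 * N2 * N3 * N4 * N6, by ring⟩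
    · exact ⟨N1 * N2 * N3 * N4 * N5, by ring⟩
  exact hC.imp lift_CF lift_CF
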